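/- The elements {b_i : i ∈ ℤ} freely generate a free subgroup of K; that is, the group homomorphism from the free group on the index set ℤ to K sending the i-th free generator to b_i is injective. -/

import Mathlib

/-- Generators of the group `K`: tree vertices `(n,τ)`, the letter `a`, and letters `bᵢ`. -/
inductive KGen : Type
  | vert : ℕ → List ℤ → KGen
  | a : KGen
  | b : ℤ → KGen
  deriving DecidableEq

/-- The parent `(n,τ)⁻` of a vertex `(n,τ)` of the tree `T`. -/
def parent : ℕ → List ℤ → ℕ × List ℤ
  | n, [] => (n + 1, [])
  | n, τ => (n, τ.dropLast)

/-- Words over an alphabet `α` (a letter together with `true` for the letter itself,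
`false` for its formal inverse). -/
abbrev Word (α : Type) := List (α × Bool)

/-- The word `u(x,y) = x y x² y x³ y ⋯ x¹⁰⁰ y`. -/
def uWord {α : Type} (x y : α) : Word α :=
  (List.range 100).flatMap fun k => List.replicate (k + 1) (x, true) ++ [(y, true)]

/-- The relator words of the presentation of `K`:
`u((n,τ),a) ((n,τ)⁻)⁻¹` and `u((n,τ),bᵢ) ((n,τ⌢⟨i⟩))⁻¹`. -/
def KRelWords : Set (Word KGen) :=
  { w | (∃ (n : ℕ) (τ : List ℤ), w = uWord (KGen.vert n τ) KGen.a ++ [(KGen.vert (parent n τ).1 (parent n τ).2, false)]) ∨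
        (∃ (n : ℕ) (τ : List ℤ) (i : ℤ), w = uWord (KGen.vert n τ) (KGen.b i) ++ [(KGen.vert n (τ ++ [i]), false)]) }

/-- The relators of `K` as elements of the free group. -/
def KRels : Set (FreeGroup KGen) := FreeGroup.mk '' KRelWords

/-- The group `K`. -/
abbrev K := PresentedGroup KRels

/-- The product `x y x² y ⋯ xⁿ y` in a monoid. -/
def uProd {M : Type*} [Monoid M] (x y : M) (n : ℕ) : M :=
  ((List.range n).map fun k => x ^ (k + 1) * y).prod

theorem uProd_succ {M : Type*} [Monoid M] (x y : M) (n : ℕ) :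
    uProd x y (n + 1) = uProd x y n * (x ^ (n + 1) * y) := by
  simp [uProd, List.range_succ]

theorem map_uProd {M N : Type*} [Monoid M] [Monoid N] (f : M →* N) (x y : M) (n : ℕ) :
    f (uProd x y n) = uProd (f x) (f y) n := by
  simp [uProd, map_list_prod, Function.comp_def]

theorem lift_mk_uWord {α : Type} {G : Type*} [Group G] (f : α → G) (x y z : α) :
    FreeGroup.lift f (FreeGroup.mk (uWord x y ++ [(z, false)])) =
      uProd (f x) (f y) 100 * (f z)⁻¹ := by
  rw [FreeGroup.lift_mk, List.map_append, List.prod_append]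
  congr 1
  · simp [uWord, uProd, List.flatMap, List.map_flatten, List.prod_flatten, Function.comp_def]
  · simp

/-- If no nontrivial power of `g` lies in `H`, then the copies of `g` in the amalgamated product
over `H` of copies of `G` freely generate a free group. -/
theorem injective_lift_of_zpow_notMem {ι G : Type*} [Group G] (H : Subgroup G) (g : G)
    (hg : ∀ k : ℤ, k ≠ 0 → g ^ k ∉ H) :
    Function.Injective (FreeGroup.lift fun i : ι =>
      (Monoid.PushoutI.of i g : Monoid.PushoutI fun _ : ι => H.subtype)) := by
  classical
  let p : FreeGroup Unit →* G := FreeGroup.lift fun _ => g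
  have hp : ∀ x : FreeGroup Unit, x ≠ 1 → p x ∉ H := by
    refine FreeGroup.freeGroupUnitEquivInt.forall_congr_left.mpr ?_
    intro k hk
    change FreeGroup.of () ^ k ≠ 1 at hk
    change p (FreeGroup.of () ^ k) ∉ H
    rw [map_zpow, FreeGroup.lift_apply_of]
    refine hg k ?_
    rintro rfl
    simp at hk
  let q : Monoid.CoprodI (fun _ : ι => FreeGroup Unit) →*
      Monoid.PushoutI fun _ : ι => H.subtype :=
    Monoid.CoprodI.lift fun i => (Monoid.PushoutI.of i).comp p
  have hq : FreeGroup.lift (fun i : ι =>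
      (Monoid.PushoutI.of i g : Monoid.PushoutI fun _ : ι => H.subtype)) =
      q.comp freeGroupEquivCoprodI.toMonoidHom := by
    ext i
    simp [q, p]
  rw [hq, MonoidHom.coe_comp]
  refine Function.Injective.comp ?_ (MulEquiv.injective freeGroupEquivCoprodI)
  rw [injective_iff_map_eq_one]
  refine Monoid.CoprodI.Word.equiv.forall_congr_left.mpr ?_
  intro w hw
  change q w.prod = 1 at hw
  change w.prod = 1
  let w' : Monoid.CoprodI.Word fun _ : ι => G :=
    { toList := w.toList.map fun l => ⟨l.1, p l.2⟩
      ne_one := by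
        intro l hl
        obtain ⟨m, hm, rfl⟩ := List.mem_map.mp hl
        intro h
        exact hp m.2 (w.ne_one m hm) ((show p m.2 = 1 from h) ▸ H.one_mem)
      chain_ne := by
        rw [List.isChain_map]
        exact w.chain_ne }
  have hred : Monoid.PushoutI.Reduced (fun _ : ι => H.subtype) w' := by
    intro l hl
    obtain ⟨m, hm, rfl⟩ := List.mem_map.mp hl
    simpa using hp m.2 (w.ne_one m hm)
  have hprod : Monoid.PushoutI.ofCoprodI w'.prod = q w.prod := by
    simp [w', q, Monoid.CoprodI.Word.prod, map_list_prod, Function.comp_def]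
  have hempty := hred.eq_empty_of_mem_range (fun _ => H.subtype_injective)
    (by rw [hprod, hw]; exact one_mem _)
  have hnil : w.toList = [] := by
    have := congrArg Monoid.CoprodI.Word.toList hempty
    simpa [w', Monoid.CoprodI.Word.empty] using this
  simp [Monoid.CoprodI.Word.prod, hnil]

theorem injective_lift_b_of_zpow_notMem {G : Type} [Group G] (v g : G)
    (hu : uProd v g 100 = v) (hg : ∀ k : ℤ, k ≠ 0 → g ^ k ∉ Subgroup.zpowers v) :
    Function.Injective (FreeGroup.lift fun i : ℤ => (PresentedGroup.of (KGen.b i) : K)) := by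
  let φ : ℤ → Subgroup.zpowers v →* G := fun _ => (Subgroup.zpowers v).subtype
  let v₀ : Monoid.PushoutI φ := Monoid.PushoutI.base φ ⟨v, Subgroup.mem_zpowers v⟩
  have hof : ∀ i : ℤ, (Monoid.PushoutI.of i v : Monoid.PushoutI φ) = v₀ := fun i =>
    Monoid.PushoutI.of_apply_eq_base φ i ⟨v, Subgroup.mem_zpowers v⟩
  have hrel : ∀ i : ℤ, uProd v₀ (Monoid.PushoutI.of i g : Monoid.PushoutI φ) 100 = v₀ := by
    intro i
    rw [← hof i, ← map_uProd, hu]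
  let f : KGen → Monoid.PushoutI φ
    | .vert _ _ => v₀
    | .a => Monoid.PushoutI.of (0 : ℤ) g
    | .b i => Monoid.PushoutI.of i g
  have hf : ∀ r ∈ KRels, FreeGroup.lift f r = 1 := by
    rintro _ ⟨w, ⟨n, τ, rfl⟩ | ⟨n, τ, i, rfl⟩, rfl⟩
    · rw [lift_mk_uWord]
      exact mul_inv_eq_one.mpr (hrel 0)
    · rw [lift_mk_uWord]
      exact mul_inv_eq_one.mpr (hrel i)
  have hcomp : (PresentedGroup.toGroup hf).comp
      (FreeGroup.lift fun i : ℤ => (PresentedGroup.of (KGen.b i) : K)) =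
      FreeGroup.lift fun i : ℤ => (Monoid.PushoutI.of i g : Monoid.PushoutI φ) := by
    ext i
    simp [f]
  refine Function.Injective.of_comp (f := PresentedGroup.toGroup hf) ?_
  rw [← MonoidHom.coe_comp, hcomp]
  exact injective_lift_of_zpow_notMem _ g hg

theorem exists_root_of_deriv_neg {f : ℝ → ℝ} {f' : ℝ} (hc : Continuous f) (h0 : f 0 < 0)
    (h1 : f 1 = 0) (hd : HasDerivAt f f' 1) (hf' : f' < 0) : ∃ w, 0 < w ∧ w < 1 ∧ f w = 0 := by
  have hs := (hasDerivAt_iff_tendsto_slope.mp hd).eventually (gt_mem_nhds hf')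
  have hs' := hs.filter_mono (nhdsWithin_mono (1 : ℝ) (t := {1}ᶜ) (s := Set.Iio 1) (fun x hx => ne_of_lt hx))
  obtain ⟨x, hx, hx0, hx1⟩ :=
    (hs'.and (Ioo_mem_nhdsLT (zero_lt_one : (0 : ℝ) < 1))).exists
  have hpos : 0 < f x := by
    rw [slope_def_field, h1, sub_zero, div_neg_iff] at hx
    rcases hx with hx | hx
    · exact hx.1
    · linarith [hx.2]
  obtain ⟨w, ⟨hw0, hwx⟩, hw⟩ := intermediate_value_Ioo hx0.le hc.continuousOn ⟨h0, hpos⟩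
  exact ⟨w, hw0, hwx.trans hx1, hw⟩

theorem exists_root_alternating_sum : ∃ w : ℝ, 0 < w ∧ w < 1 ∧
    ∑ j ∈ Finset.range 100, (-1) ^ j * w ^ (50 * j ^ 2 + 120001 - 4899 * j) = 0 := by
  refine exists_root_of_deriv_neg
    (f' := ∑ j ∈ Finset.range 100, (-1) ^ j * ((50 * j ^ 2 + 120001 - 4899 * j : ℕ) : ℝ))
    (by fun_prop) ?_ ?_ ?_ ?_
  · have h : ∑ j ∈ Finset.range 100,
        (-1 : ℤ) ^ j * (if 50 * j ^ 2 + 120001 - 4899 * j = 0 then 1 else 0) < 0 := by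
      decide +kernel
    simp only [zero_pow_eq]
    exact_mod_cast h
  · have h : ∑ j ∈ Finset.range 100, (-1 : ℤ) ^ j = 0 := by decide +kernel
    simp only [one_pow, mul_one]
    exact_mod_cast h
  · refine HasDerivAt.fun_sum fun j _ => ?_
    simpa using (hasDerivAt_pow (50 * j ^ 2 + 120001 - 4899 * j) (1 : ℝ)).const_mul ((-1) ^ j)
  · have h : ∑ j ∈ Finset.range 100,
        (-1 : ℤ) ^ j * ((50 * j ^ 2 + 120001 - 4899 * j : ℕ) : ℤ) < 0 := by
      decide +kernel
    exact_mod_cast h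

theorem uProd_perm_apply (v g : Equiv.Perm ℝ) (w s : ℝ) (hv : ∀ x, v x = w ^ 100 * x)
    (hg : ∀ x, g x = s * x + 1) (n : ℕ) (x : ℝ) :
    uProd v g n x = s ^ n * w ^ (50 * n * (n + 1)) * x +
      ∑ j ∈ Finset.range n, s ^ j * w ^ (50 * (j + 1) * (j + 2)) := by
  have hpow : ∀ (k : ℕ) (x : ℝ), (v ^ k) x = w ^ (100 * k) * x := by
    intro k
    induction k with
    | zero => simp
    | succ k ih =>
      intro x
      rw [pow_succ, Equiv.Perm.mul_apply, hv, ih]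
      ring
  induction n generalizing x with
  | zero => simp [uProd]
  | succ n ih =>
    rw [uProd_succ, Equiv.Perm.mul_apply, Equiv.Perm.mul_apply, hpow, hg, ih,
      Finset.sum_range_succ]
    ring

theorem exists_uProd_eq_self : ∃ v g : Equiv.Perm ℝ, uProd v g 100 = v ∧
    ∀ k : ℤ, k ≠ 0 → g ^ k ∉ Subgroup.zpowers v := by
  obtain ⟨w, hw0, hw1, hw⟩ := exists_root_alternating_sum
  let t : ℝˣ := Units.mk0 w hw0.ne' ^ 100
  let s : ℝˣ := -(Units.mk0 w hw0.ne' ^ 5049)⁻¹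
  have ht : (t : ℝ) = w ^ 100 := by simp [t]
  have hs : (s : ℝ) = -(w ^ 5049)⁻¹ := by simp [s]
  have hs0 : (s : ℝ) < -1 := by
    rw [hs, neg_lt_neg_iff]
    exact (one_lt_inv₀ (by positivity)).mpr (pow_lt_one₀ hw0.le hw1 (by norm_num))
  have hs1 : 1 - (s : ℝ) ≠ 0 := by linarith
  let c : ℝ := (1 - (s : ℝ))⁻¹
  have hc : c * (1 - (s : ℝ)) = 1 := inv_mul_cancel₀ hs1
  let m : ℝˣ →* Equiv.Perm ℝ := MulAction.toPermHom ℝˣ ℝ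
  have hm : ∀ (r : ℝˣ) (x : ℝ), m r x = r * x := fun r x => rfl
  let g : Equiv.Perm ℝ := Equiv.addRight c * m s * (Equiv.addRight c)⁻¹
  have hg : ∀ x, g x = s * x + 1 := by
    intro x
    simp only [g, Equiv.Perm.mul_apply, hm, Equiv.Perm.inv_def, Equiv.addRight_symm,
      Equiv.coe_addRight]
    linear_combination hc
  refine ⟨m t, g, ?_, ?_⟩
  · ext x
    rw [uProd_perm_apply (m t) g w s (fun x => by rw [hm, ht]) hg, hm]
    have hsw : (s : ℝ) * w ^ 5049 = -1 := by
      rw [hs, neg_mul, inv_mul_cancel₀ (by positivity)]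
    have hlin : (s : ℝ) ^ 100 * w ^ (50 * 100 * (100 + 1)) = (t : ℝ) := by
      rw [show 50 * 100 * (100 + 1) = 5049 * 100 + 100 by norm_num, pow_add, ← mul_assoc,
        pow_mul, ← mul_pow, hsw, ht]
      norm_num
    have hsum : ∑ j ∈ Finset.range 100, (s : ℝ) ^ j * w ^ (50 * (j + 1) * (j + 2)) = 0 := by
      refine (mul_eq_zero_iff_right (pow_ne_zero 119901 hw0.ne')).mp ?_
      rw [Finset.sum_mul, ← hw]
      refine Finset.sum_congr rfl fun j hj => ?_
      have hexp : 50 * (j + 1) * (j + 2) + 119901 =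
          5049 * j + (50 * j ^ 2 + 120001 - 4899 * j) := by
        have hj' := Finset.mem_range.mp hj
        have hle : 4899 * j ≤ 50 * j ^ 2 + 120001 := by
          interval_cases j <;> norm_num
        zify [hle]
        ring
      rw [mul_assoc, ← pow_add, hexp, pow_add, ← mul_assoc, pow_mul, ← mul_pow, hsw]
    rw [hlin, hsum, add_zero]
  · rintro k hk ⟨l, hl⟩
    have hl0 := congrArg (fun e : Equiv.Perm ℝ => e 0) hl
    simp only [g, conj_zpow, ← map_zpow] at hl0
    simp only [Equiv.Perm.mul_apply, hm, Equiv.Perm.inv_def,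
      Equiv.addRight_symm, Equiv.coe_addRight] at hl0
    have hc0 : c ≠ 0 := inv_ne_zero hs1
    have hsk : ((s ^ k : ℝˣ) : ℝ) = 1 := by
      refine mul_right_cancel₀ hc0 ?_
      linear_combination hl0
    rw [Units.val_zpow_eq_zpow_val] at hsk
    have habs := congrArg abs hsk
    rw [abs_zpow, abs_one, zpow_eq_one_iff_right₀ (abs_nonneg _)
      (by rw [abs_of_neg (by linarith)]; linarith)] at habs
    exact hk habs

/-- The `bᵢ` freely generate a free subgroup of `K`: the homomorphism from the free group on
`ℤ` sending the `i`-th generator to `bᵢ` is injective. -/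
theorem stmt9 :
    Function.Injective (FreeGroup.lift fun i : ℤ => (PresentedGroup.of (KGen.b i) : K)) := by
  obtain ⟨v, g, hu, hg⟩ := exists_uProd_eq_self
  exact injective_lift_b_of_zpow_notMem v g hu hg
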